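/- (MvFIF convergence.) Let m, n be positive integers, h : ZMod m → ℝ an even function (h(-j)=h(j)), and w = h ⋆ h its circular self-convolution, assumed to satisfy w(j) ≥ 0 for all j and Σ_j w(j) = 1; let W be the circulant matrix associated with w. Let u_1, …, u_n : ZMod m → ℝ be the n channels of a multivariate signal. Then for every δ > 0 there exists N₀ : ℕ such that for all k ≥ N₀, max over i = 1,…,n of ‖(I - W)^k.mulVec u_i - (I - W)^{k+1}.mulVec u_i‖₂ < δ; i.e., the stopping criterion of the Multivariate Fast Iterative Filtering inner loop is satisfied after finitely many iterations. -/

import Mathlib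

open scoped BigOperators
open Matrix

open Filter Topology

/-- If a real symmetric matrix `A` has all its eigenvalues in `[0, 2)`, then consecutive powers of
`1 - A` become arbitrarily close. -/
theorem Matrix.IsHermitian.tendsto_one_sub_pow_sub_pow_succ {ι : Type*} [Fintype ι] [DecidableEq ι]
    {A : Matrix ι ι ℝ} (hA : A.IsHermitian) (h_nonneg : ∀ i, 0 ≤ hA.eigenvalues i)
    (h_lt : ∀ i, hA.eigenvalues i < 2) :
    Tendsto (fun k : ℕ => (1 - A) ^ k - (1 - A) ^ (k + 1)) atTop (𝓝 0) := by
  set φ := Unitary.conjStarAlgAut ℝ (Matrix ι ι ℝ) hA.eigenvectorUnitary with hφ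
  set d := hA.eigenvalues
  have hAφ : A = φ (diagonal d) := hA.spectral_theorem
  have h_pow (k : ℕ) : (1 - A) ^ k - (1 - A) ^ (k + 1) =
      φ (diagonal fun i => (1 - d i) ^ k * d i) := by
    have h_one_sub : 1 - A = φ (diagonal fun i => 1 - d i) := by
      rw [← diagonal_sub, diagonal_one, map_sub, map_one, ← hAφ]
    rw [h_one_sub, ← map_pow, ← map_pow, ← map_sub, diagonal_pow, diagonal_pow, diagonal_sub]
    congr 2
    ext i
    simp only [Pi.pow_apply]
    ring
  have h_diag : Tendsto (fun k : ℕ => fun i => (1 - d i) ^ k * d i) atTop (𝓝 0) := by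
    refine tendsto_pi_nhds.2 fun i => ?_
    rcases (h_nonneg i).eq_or_lt with h0 | h0
    · have : d i = 0 := h0.symm
      simp [this]
    · have h_abs : |1 - d i| < 1 := abs_lt.2 ⟨by linarith [h_lt i], by linarith⟩
      simpa using (tendsto_pow_atTop_nhds_zero_of_abs_lt_one h_abs).mul_const (d i)
  have h_cont : Continuous fun v : ι → ℝ => φ (diagonal v) := by
    simp only [hφ, Unitary.conjStarAlgAut_apply]
    fun_prop
  simp only [h_pow]
  simpa [Function.comp_def] using (h_cont.tendsto 0).comp h_diag

/-- The circulant matrix of an even function is symmetric. -/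
theorem Matrix.isHermitian_circulant_of_even {G : Type*} [AddGroup G] {h : G → ℝ}
    (h_even : ∀ j, h (-j) = h j) : (circulant h).IsHermitian := by
  ext i j
  simp [circulant_apply, ← h_even (i - j)]

/-- The circulant matrix of a circular self-convolution is the square of a circulant matrix. -/
theorem Matrix.circulant_eq_mul_self {G : Type*} [AddCommGroup G] [Fintype G] {h w : G → ℝ}
    (hw : ∀ j, w j = ∑ q, h q * h (j - q)) : circulant w = circulant h * circulant h := by
  rw [circulant_mul]
  congr 1
  ext j
  rw [hw]
  simp only [mulVec, dotProduct, circulant_apply]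
  exact Fintype.sum_equiv (Equiv.subLeft j) _ _ fun q => by simp

/-- The eigenvalues of the circulant matrix of a nonnegative weight are at most its mass. -/
theorem Matrix.eigenvalue_circulant_le_sum {G : Type*} [AddGroup G] [Fintype G] [DecidableEq G]
    {w : G → ℝ} (hpos : ∀ j, 0 ≤ w j) {μ : ℝ}
    (hμ : Module.End.HasEigenvalue (Matrix.toLin' (circulant w)) μ) : μ ≤ ∑ j, w j := by
  obtain ⟨k, hk⟩ := eigenvalue_mem_ball hμ
  have h_row : ∑ j, circulant w k j = ∑ j, w j :=
    Fintype.sum_equiv (Equiv.subLeft k) _ _ fun j => by simp [circulant_apply]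
  rw [Metric.mem_closedBall, Real.dist_eq] at hk
  have h_norm : ∑ j ∈ Finset.univ.erase k, ‖circulant w k j‖ =
      ∑ j ∈ Finset.univ.erase k, circulant w k j :=
    Finset.sum_congr rfl fun j _ => Real.norm_of_nonneg (hpos _)
  rw [← h_row, ← Finset.add_sum_erase _ _ (Finset.mem_univ k)]
  linarith [le_abs_self (μ - circulant w k k)]

/-- **MvFIF convergence.** Let `h` be an even function and `w = h ⋆ h` its
circular self-convolution, nonnegative and summing to `1`, with associated
circulant matrix `W`. For any `n` channels `u i` and any `δ > 0` there is `N₀`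
such that for all `k ≥ N₀` and every channel `i`,
`‖(I - W)^k.mulVec (u i) - (I - W)^(k+1).mulVec (u i)‖₂ < δ`: the stopping
criterion of the MvFIF inner loop is satisfied after finitely many steps. -/
theorem mvFIF_convergence (m n : ℕ) [NeZero m] (hn : 0 < n)
    (h w : ZMod m → ℝ) (heven : ∀ j : ZMod m, h (-j) = h j)
    (hw : ∀ j : ZMod m, w j = ∑ q : ZMod m, h q * h (j - q))
    (hpos : ∀ j, 0 ≤ w j) (hsum : ∑ j : ZMod m, w j = 1)
    (u : Fin n → ZMod m → ℝ) (δ : ℝ) (hδ : 0 < δ) :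
    ∃ N₀ : ℕ, ∀ k ≥ N₀, ∀ i : Fin n,
      Real.sqrt (∑ j : ZMod m,
        ((((1 - Matrix.circulant w) ^ k).mulVec (u i)
          - ((1 - Matrix.circulant w) ^ (k + 1)).mulVec (u i)) j) ^ 2) < δ := by
  have hH := isHermitian_circulant_of_even heven
  have hW_psd : (circulant w).PosSemidef := by
    rw [circulant_eq_mul_self hw]
    simpa only [hH.eq] using posSemidef_conjTranspose_mul_self (circulant h)
  have h_le (i : ZMod m) : hW_psd.1.eigenvalues i ≤ 1 := by
    rw [← hsum]
    refine eigenvalue_circulant_le_sum hpos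
      (Module.End.hasEigenvalue_of_hasEigenvector (x := ⇑(hW_psd.1.eigenvectorBasis i)) ⟨?_, ?_⟩)
    · rw [Module.End.mem_eigenspace_iff, toLin'_apply]
      exact hW_psd.1.mulVec_eigenvectorBasis i
    · intro h0
      exact hW_psd.1.eigenvectorBasis.orthonormal.ne_zero i (by ext j; exact congrFun h0 j)
  have h_tendsto := hW_psd.1.tendsto_one_sub_pow_sub_pow_succ hW_psd.eigenvalues_nonneg
    fun i => (h_le i).trans_lt one_lt_two
  have h_cont (i : Fin n) : Continuous fun M : Matrix (ZMod m) (ZMod m) ℝ =>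
      Real.sqrt (∑ j, (M.mulVec (u i)) j ^ 2) := by
    fun_prop
  have h_ev : ∀ᶠ k in atTop, ∀ i : Fin n, Real.sqrt (∑ j : ZMod m,
      (((1 - circulant w) ^ k - (1 - circulant w) ^ (k + 1)).mulVec (u i) j) ^ 2) < δ :=
    eventually_all.2 fun i =>
      (((h_cont i).tendsto 0).comp h_tendsto).eventually_lt_const (by simpa using hδ)
  simpa only [sub_mulVec] using eventually_atTop.1 h_ev
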